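/- Let n ≥ 1. For every M > 0 there exists a constant C > 0 such that for all x, y ∈ ℝⁿ with x ≠ y and |x-y| ≤ M ρ(x), and all t > 0, |P_t^L(x,y) - P_t(x-y)| ≤ C (|x-y|/ρ(x))^{1/2} |x-y|^{-n}. -/

import Mathlib

open Real MeasureTheory Set

/-- The Mehler (Hermite heat) kernel on ℝⁿ. -/
noncomputable def W (n : ℕ) (s : ℝ) (x y : EuclideanSpace ℝ (Fin n)) : ℝ :=
  (Real.exp (-2 * s) / (Real.pi * (1 - Real.exp (-4 * s)))) ^ ((n : ℝ) / 2) *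
    Real.exp (-(1 / 4) * ((1 + Real.exp (-2 * s)) / (1 - Real.exp (-2 * s)) * ‖x - y‖ ^ 2 +
      (1 - Real.exp (-2 * s)) / (1 + Real.exp (-2 * s)) * ‖x + y‖ ^ 2))

/-- The Hermite-Poisson kernel. -/
noncomputable def P (n : ℕ) (t : ℝ) (x y : EuclideanSpace ℝ (Fin n)) : ℝ :=
  t / Real.sqrt (4 * Real.pi) *
    ∫ s in Set.Ioi (0 : ℝ), s ^ (-(3 : ℝ) / 2) * Real.exp (-t ^ 2 / (4 * s)) * W n s x y

/-- The critical radius function ρ for the Hermite operator. -/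
noncomputable def rho (n : ℕ) (x : EuclideanSpace ℝ (Fin n)) : ℝ :=
  if 1 ≤ ‖x‖ then 1 / (1 + ‖x‖) else 1 / 2

/-- The classical Poisson kernel on ℝⁿ. -/
noncomputable def Pclass (n : ℕ) (t : ℝ) (x : EuclideanSpace ℝ (Fin n)) : ℝ :=
  Real.Gamma (((n : ℝ) + 1) / 2) * Real.pi ^ (-((n : ℝ) + 1) / 2) * t *
    (t ^ 2 + ‖x‖ ^ 2) ^ (-((n : ℝ) + 1) / 2)

/-- The Gauss–Weierstrass (classical heat) kernel on `ℝⁿ` at time `s`, as a function of the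
distance `r`. -/
noncomputable def heatKernel (n : ℕ) (s r : ℝ) : ℝ :=
  (1 / (4 * π * s)) ^ ((n : ℝ) / 2) * exp (-r ^ 2 / (4 * s))

lemma heatKernel_nonneg (n : ℕ) {s : ℝ} (hs : 0 < s) (r : ℝ) : 0 ≤ heatKernel n s r := by
  unfold heatKernel
  positivity

lemma integral_rpow_mul_exp_neg_div_Ioi {a b : ℝ} (ha : 0 < a) (hb : 0 < b) :
    ∫ s in Ioi (0 : ℝ), s ^ (-a - 1) * exp (-b / s) = (1 / b) ^ a * Real.Gamma a := by
  rw [← Real.integral_rpow_mul_exp_neg_mul_Ioi ha hb,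
    ← integral_comp_rpow_Ioi (fun t => t ^ (a - 1) * exp (-(b * t))) (p := -1) (by norm_num)]
  refine setIntegral_congr_fun measurableSet_Ioi fun s hs => ?_
  have hs : 0 < s := hs
  simp only [smul_eq_mul, abs_neg, abs_one, one_mul]
  rw [← rpow_mul hs.le, ← mul_assoc, ← rpow_add hs, rpow_neg_one, neg_div, div_eq_mul_inv]
  congr 2
  ring

lemma integrableOn_rpow_mul_exp_neg_div_Ioi {a b : ℝ} (ha : 0 < a) (hb : 0 < b) :
    IntegrableOn (fun s : ℝ => s ^ (-a - 1) * exp (-b / s)) (Ioi 0) := by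
  by_contra h
  have hzero := integral_undef h
  rw [integral_rpow_mul_exp_neg_div_Ioi ha hb] at hzero
  have := Real.Gamma_pos_of_pos ha
  exact absurd hzero (by positivity)

lemma mehler_prefactor_bounds {s : ℝ} (hs : 0 < s) :
    exp (-2 * s) / (4 * π * s) ≤ exp (-2 * s) / (π * (1 - exp (-4 * s))) ∧
      exp (-2 * s) / (π * (1 - exp (-4 * s))) ≤ 1 / (4 * π * s) := by
  have h1 : exp (-4 * s) < 1 := by
    rw [exp_lt_one_iff]; linarith
  have h2 : 1 - exp (-4 * s) ≤ 4 * s := by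
    linarith [add_one_le_exp (-4 * s)]
  have h3 : 2 * s ≤ sinh (2 * s) := self_le_sinh_iff.2 (by linarith)
  have h4 : exp (2 * s) * exp (-2 * s) = 1 := by rw [← exp_add]; simp
  have h5 : exp (-4 * s) = exp (-2 * s) * exp (-2 * s) := by rw [← exp_add]; ring_nf
  rw [sinh_eq, ← neg_mul] at h3
  have hpos : 0 < π * (1 - exp (-4 * s)) := mul_pos pi_pos (by linarith)
  constructor
  · refine div_le_div_of_nonneg_left (exp_pos _).le hpos ?_
    nlinarith [pi_pos]
  · rw [div_le_div_iff₀ hpos (by positivity)]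
    have h6 : 4 * s * exp (-2 * s) ≤ 1 - exp (-4 * s) := by
      nlinarith [exp_pos (-2 * s)]
    nlinarith [pi_pos]

lemma sinh_le_self_mul_cosh {s : ℝ} (hs : 0 ≤ s) : sinh s ≤ s * cosh s := by
  have hmono : MonotoneOn (fun u => u * cosh u - sinh u) (Ici 0) := by
    refine monotoneOn_of_deriv_nonneg (convex_Ici 0) (by fun_prop) (by fun_prop) fun u hu => ?_
    have hu : 0 < u := by simpa using hu
    have hd : HasDerivAt (fun u => u * cosh u - sinh u) (1 * cosh u + u * sinh u - cosh u) u :=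
      ((hasDerivAt_id u).mul (hasDerivAt_cosh u)).sub (hasDerivAt_sinh u)
    rw [hd.deriv]
    nlinarith [mul_pos hu (sinh_pos_iff.2 hu)]
  have := hmono (mem_Ici.2 le_rfl) hs hs
  simp at this
  linarith

lemma self_mul_cosh_le {s : ℝ} (hs : 0 ≤ s) : s * cosh s ≤ (1 + s ^ 2) * sinh s := by
  have h1 : s ≤ sinh s := self_le_sinh_iff.2 hs
  have h2 := sinh_le_self_mul_cosh (div_nonneg hs zero_le_two)
  have hcosh : cosh s = 1 + 2 * sinh (s / 2) ^ 2 := by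
    conv_lhs => rw [← mul_div_cancel₀ s two_ne_zero, cosh_two_mul, cosh_sq]
    ring
  have hsinh : sinh s = 2 * sinh (s / 2) * cosh (s / 2) := by
    rw [← sinh_two_mul, mul_div_cancel₀ s two_ne_zero]
  have h3 : 0 ≤ sinh (s / 2) := sinh_nonneg_iff.2 (by linarith)
  have h4 : cosh s - 1 ≤ s * sinh s := by
    have := mul_le_mul_of_nonneg_left h2 h3
    rw [hcosh, hsinh]
    nlinarith [mul_nonneg hs (mul_nonneg h3 (cosh_pos (s / 2)).le)]
  nlinarith [mul_le_mul_of_nonneg_left h4 hs]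

lemma mehler_coefficient_bounds {s : ℝ} (hs : 0 < s) :
    1 / s ≤ (1 + exp (-2 * s)) / (1 - exp (-2 * s)) ∧
      (1 + exp (-2 * s)) / (1 - exp (-2 * s)) ≤ 1 / s + s ∧
      0 ≤ (1 - exp (-2 * s)) / (1 + exp (-2 * s)) ∧
      (1 - exp (-2 * s)) / (1 + exp (-2 * s)) ≤ s := by
  have hE : exp (-2 * s) = exp (-s) * exp (-s) := by rw [← exp_add]; ring_nf
  have h1 : exp s * exp (-s) = 1 := by rw [← exp_add]; simp
  have hc : 1 + exp (-2 * s) = 2 * exp (-s) * cosh s := by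
    rw [cosh_eq, hE, ← h1]; ring
  have hd : 1 - exp (-2 * s) = 2 * exp (-s) * sinh s := by
    rw [sinh_eq, hE, ← h1]; ring
  have hs' : 0 < sinh s := sinh_pos_iff.2 hs
  have hc' : 0 < cosh s := cosh_pos s
  have he : 2 * exp (-s) ≠ 0 := by positivity
  rw [hc, hd, mul_div_mul_left _ _ he, mul_div_mul_left _ _ he]
  have hle := sinh_le_self_mul_cosh hs.le
  refine ⟨?_, ?_, by positivity, ?_⟩
  · rw [div_le_div_iff₀ hs hs']; linarith
  · have : 1 / s + s = (1 + s ^ 2) / s := by field_simp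
    rw [this, div_le_div_iff₀ hs' hs]
    linarith [self_mul_cosh_le hs.le]
  · rw [div_le_iff₀ hc']; exact hle

lemma W_le_heatKernel (n : ℕ) {s : ℝ} (hs : 0 < s) (x y : EuclideanSpace ℝ (Fin n)) :
    W n s x y ≤ heatKernel n s ‖x - y‖ := by
  obtain ⟨hA', hA⟩ := mehler_prefactor_bounds hs
  obtain ⟨hB, -, hT, -⟩ := mehler_coefficient_bounds hs
  have hA0 : 0 ≤ exp (-2 * s) / (π * (1 - exp (-4 * s))) :=
    le_trans (by positivity) hA'
  unfold W heatKernel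
  gcongr
  have h1 := mul_le_mul_of_nonneg_right hB (sq_nonneg ‖x - y‖)
  have h2 := mul_nonneg hT (sq_nonneg ‖x + y‖)
  have h3 : -‖x - y‖ ^ 2 / (4 * s) = -(1 / 4) * (1 / s * ‖x - y‖ ^ 2) := by field_simp
  rw [h3]
  linarith

lemma heatKernel_mul_exp_le_W (n : ℕ) {s : ℝ} (hs : 0 < s) (x y : EuclideanSpace ℝ (Fin n)) :
    heatKernel n s ‖x - y‖ * exp (-(s * (n + ‖x - y‖ ^ 2 / 4 + ‖x + y‖ ^ 2 / 4))) ≤ W n s x y := by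
  obtain ⟨hA, -⟩ := mehler_prefactor_bounds hs
  obtain ⟨-, hB, -, hT⟩ := mehler_coefficient_bounds hs
  have hsplit : heatKernel n s ‖x - y‖ *
      exp (-(s * (n + ‖x - y‖ ^ 2 / 4 + ‖x + y‖ ^ 2 / 4))) =
      (exp (-2 * s) / (4 * π * s)) ^ ((n : ℝ) / 2) *
        exp (-(1 / 4) * ((1 / s + s) * ‖x - y‖ ^ 2 + s * ‖x + y‖ ^ 2)) := by
    unfold heatKernel
    have hexp : -‖x - y‖ ^ 2 / (4 * s) + -(s * (n + ‖x - y‖ ^ 2 / 4 + ‖x + y‖ ^ 2 / 4)) =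
        -2 * s * (n / 2) + -(1 / 4) * ((1 / s + s) * ‖x - y‖ ^ 2 + s * ‖x + y‖ ^ 2) := by
      field_simp
      ring
    rw [div_eq_mul_one_div (exp (-2 * s)), mul_rpow (exp_pos _).le (by positivity), ← exp_mul,
      mul_assoc, ← exp_add, hexp, exp_add]
    ring
  rw [hsplit]
  unfold W
  have h1 := mul_le_mul_of_nonneg_right hB (sq_nonneg ‖x - y‖)
  have h2 := mul_le_mul_of_nonneg_right hT (sq_nonneg ‖x + y‖)
  refine mul_le_mul (rpow_le_rpow (by positivity) hA (by positivity)) (exp_le_exp.2 ?_)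
    (exp_pos _).le (rpow_nonneg (le_trans (by positivity) hA) _)
  linarith

lemma one_sub_exp_neg_le_rpow {z : ℝ} (hz : 0 ≤ z) : 1 - exp (-z) ≤ z ^ (1 / 4 : ℝ) := by
  rcases le_total z 1 with h | h
  · have : z ^ (1 : ℝ) ≤ z ^ (1 / 4 : ℝ) :=
      rpow_le_rpow_of_exponent_ge' hz h (by norm_num) (by norm_num)
    rw [rpow_one] at this
    linarith [add_one_le_exp (-z)]
  · linarith [one_le_rpow h (by norm_num : (0 : ℝ) ≤ 1 / 4), exp_pos (-z)]

lemma abs_W_sub_heatKernel_le (n : ℕ) {s Q : ℝ} (hs : 0 < s) (x y : EuclideanSpace ℝ (Fin n))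
    (hQ : n + ‖x - y‖ ^ 2 / 4 + ‖x + y‖ ^ 2 / 4 ≤ Q) :
    |W n s x y - heatKernel n s ‖x - y‖| ≤ heatKernel n s ‖x - y‖ * (s * Q) ^ (1 / 4 : ℝ) := by
  have hH := heatKernel_nonneg n hs ‖x - y‖
  have hQ0 : 0 ≤ Q := le_trans (by positivity) hQ
  have hexp : exp (-(s * Q)) ≤ exp (-(s * (n + ‖x - y‖ ^ 2 / 4 + ‖x + y‖ ^ 2 / 4))) := by
    gcongr
  rw [abs_sub_comm, abs_of_nonneg (sub_nonneg.2 (W_le_heatKernel n hs x y))]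
  nlinarith [heatKernel_mul_exp_le_W n hs x y, mul_le_mul_of_nonneg_left hexp hH,
    mul_le_mul_of_nonneg_left (one_sub_exp_neg_le_rpow (mul_nonneg hs.le hQ0)) hH]

lemma W_nonneg (n : ℕ) {s : ℝ} (hs : 0 < s) (x y : EuclideanSpace ℝ (Fin n)) : 0 ≤ W n s x y :=
  le_trans (mul_nonneg (heatKernel_nonneg n hs _) (exp_pos _).le) (heatKernel_mul_exp_le_W n hs x y)

lemma subordinated_heatKernel_eq (n : ℕ) (t r q : ℝ) {s : ℝ} (hs : 0 < s) :
    s ^ (-(3 : ℝ) / 2) * exp (-t ^ 2 / (4 * s)) * (heatKernel n s r * s ^ q) =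
      (1 / (4 * π)) ^ ((n : ℝ) / 2) *
        (s ^ (-(((n : ℝ) + 1) / 2 - q) - 1) * exp (-((t ^ 2 + r ^ 2) / 4) / s)) := by
  have hexp : -((t ^ 2 + r ^ 2) / 4) / s = -t ^ 2 / (4 * s) + -r ^ 2 / (4 * s) := by
    field_simp
    ring
  have hpow : s ^ (-(((n : ℝ) + 1) / 2 - q) - 1) =
      s ^ (-(3 : ℝ) / 2) * s ^ (-((n : ℝ) / 2)) * s ^ q := by
    rw [← rpow_add hs, ← rpow_add hs]
    congr 1
    ring
  have hbase : (1 / (4 * π * s)) ^ ((n : ℝ) / 2) =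
      (1 / (4 * π)) ^ ((n : ℝ) / 2) * s ^ (-((n : ℝ) / 2)) := by
    rw [← div_div, div_eq_mul_inv _ s, mul_rpow (by positivity) (by positivity),
      inv_rpow hs.le, rpow_neg hs.le]
  rw [heatKernel, hexp, hpow, hbase, exp_add]
  ring

lemma integral_subordinated_heatKernel (n : ℕ) {t r q : ℝ} (ht : 0 < t)
    (hq : q < ((n : ℝ) + 1) / 2) :
    ∫ s in Ioi (0 : ℝ),
        s ^ (-(3 : ℝ) / 2) * exp (-t ^ 2 / (4 * s)) * (heatKernel n s r * s ^ q) =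
      (1 / (4 * π)) ^ ((n : ℝ) / 2) * ((4 / (t ^ 2 + r ^ 2)) ^ (((n : ℝ) + 1) / 2 - q) *
        Real.Gamma (((n : ℝ) + 1) / 2 - q)) := by
  rw [setIntegral_congr_fun measurableSet_Ioi fun s hs => subordinated_heatKernel_eq n t r q hs,
    integral_const_mul, integral_rpow_mul_exp_neg_div_Ioi (by linarith) (by positivity),
    one_div_div]

lemma integrableOn_subordinated_heatKernel (n : ℕ) {t r q : ℝ} (ht : 0 < t)
    (hq : q < ((n : ℝ) + 1) / 2) :
    IntegrableOn (fun s => s ^ (-(3 : ℝ) / 2) * exp (-t ^ 2 / (4 * s)) *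
      (heatKernel n s r * s ^ q)) (Ioi 0) := by
  refine (integrableOn_congr_fun (fun s hs => subordinated_heatKernel_eq n t r q hs)
    measurableSet_Ioi).2 ((integrableOn_rpow_mul_exp_neg_div_Ioi (by linarith)
      (by positivity)).const_mul _)

lemma integrableOn_heatKernel (n : ℕ) {t : ℝ} (r : ℝ) (ht : 0 < t) :
    IntegrableOn (fun s => s ^ (-(3 : ℝ) / 2) * exp (-t ^ 2 / (4 * s)) * heatKernel n s r)
      (Ioi 0) := by
  simpa using integrableOn_subordinated_heatKernel n (r := r) (q := 0) ht (by positivity)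

lemma integrableOn_W (n : ℕ) {t : ℝ} (ht : 0 < t) (x y : EuclideanSpace ℝ (Fin n)) :
    IntegrableOn (fun s => s ^ (-(3 : ℝ) / 2) * exp (-t ^ 2 / (4 * s)) * W n s x y) (Ioi 0) := by
  refine (integrableOn_heatKernel n ‖x - y‖ ht).mono' ?_ ?_
  · unfold W
    exact Measurable.aestronglyMeasurable (by fun_prop)
  · filter_upwards [ae_restrict_mem measurableSet_Ioi] with s hs
    have hs : 0 < s := hs
    have hW := W_nonneg n hs x y
    rw [norm_of_nonneg (by positivity)]
    gcongr
    exact W_le_heatKernel n hs x y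

/-- The classical Poisson kernel is subordinated to the classical heat kernel. -/
lemma Pclass_eq_integral (n : ℕ) {t : ℝ} (ht : 0 < t) (x : EuclideanSpace ℝ (Fin n)) :
    Pclass n t x = t / √(4 * π) *
      ∫ s in Ioi (0 : ℝ), s ^ (-(3 : ℝ) / 2) * exp (-t ^ 2 / (4 * s)) * heatKernel n s ‖x‖ := by
  have h := integral_subordinated_heatKernel n (r := ‖x‖) (q := 0) ht (by positivity)
  simp only [rpow_zero, mul_one, sub_zero] at h
  have hsum : 0 < t ^ 2 + ‖x‖ ^ 2 := by positivity
  have hneg : -((n : ℝ) + 1) / 2 = -(((n : ℝ) + 1) / 2) := by ring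
  have hpi : (1 / (4 * π)) ^ ((n : ℝ) / 2) = √(4 * π) * (4 * π) ^ (-(((n : ℝ) + 1) / 2)) := by
    rw [sqrt_eq_rpow, ← rpow_add (by positivity), one_div, inv_rpow (by positivity),
      ← rpow_neg (by positivity)]
    congr 1
    ring
  have hsqrt : √(4 * π) ≠ 0 := by positivity
  have h4 : (4 : ℝ) ^ (-(((n : ℝ) + 1) / 2)) * 4 ^ (((n : ℝ) + 1) / 2) = 1 := by
    rw [← rpow_add (by norm_num)]; simp
  rw [h, hpi, div_rpow (by norm_num) hsum.le, mul_rpow (by norm_num) pi_pos.le, Pclass, hneg,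
    rpow_neg hsum.le, div_eq_mul_inv (_ ^ _) (_ ^ _)]
  field_simp
  linear_combination (-1 : ℝ) * h4

/-- If `Q` controls the potential term of the Mehler exponent, then the two Poisson kernels differ
by at most the `Q ^ (1 / 4)`-weighted subordinated heat kernel. -/
lemma abs_P_sub_Pclass_le (n : ℕ) (hn : 1 ≤ n) {t Q : ℝ} (ht : 0 < t)
    (x y : EuclideanSpace ℝ (Fin n)) (hQ : n + ‖x - y‖ ^ 2 / 4 + ‖x + y‖ ^ 2 / 4 ≤ Q) :
    |P n t x y - Pclass n t (x - y)| ≤ t / √(4 * π) * (Q ^ (1 / 4 : ℝ) *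
      ((1 / (4 * π)) ^ ((n : ℝ) / 2) * ((4 / (t ^ 2 + ‖x - y‖ ^ 2)) ^ ((n : ℝ) / 2 + 1 / 4) *
        Real.Gamma ((n : ℝ) / 2 + 1 / 4)))) := by
  have hQ0 : 0 ≤ Q := le_trans (by positivity) hQ
  have hq : (1 / 4 : ℝ) < ((n : ℝ) + 1) / 2 := by
    have : (1 : ℝ) ≤ n := by exact_mod_cast hn
    linarith
  have ha : (n : ℝ) / 2 + 1 / 4 = ((n : ℝ) + 1) / 2 - 1 / 4 := by ring
  rw [ha, ← integral_subordinated_heatKernel n ht hq, ← integral_const_mul, Pclass_eq_integral n ht,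
    P, ← mul_sub, ← integral_sub (integrableOn_W n ht x y) (integrableOn_heatKernel n _ ht), abs_mul,
    abs_of_pos (by positivity : 0 < t / √(4 * π))]
  gcongr
  rw [← norm_eq_abs]
  refine norm_integral_le_of_norm_le
    ((integrableOn_subordinated_heatKernel n ht hq).const_mul _) ?_
  filter_upwards [ae_restrict_mem measurableSet_Ioi] with s hs
  have hs : 0 < s := hs
  have hW := abs_W_sub_heatKernel_le n hs x y hQ
  rw [mul_rpow hs.le hQ0] at hW
  rw [← mul_sub, norm_mul, norm_of_nonneg (by positivity), norm_eq_abs]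
  calc _ ≤ s ^ (-(3 : ℝ) / 2) * exp (-t ^ 2 / (4 * s)) *
        (heatKernel n s ‖x - y‖ * (s ^ (1 / 4 : ℝ) * Q ^ (1 / 4 : ℝ))) := by gcongr
    _ = _ := by ring

lemma rho_pos (n : ℕ) (x : EuclideanSpace ℝ (Fin n)) : 0 < rho n x := by
  unfold rho
  split_ifs <;> positivity

lemma rho_le_one (n : ℕ) (x : EuclideanSpace ℝ (Fin n)) : rho n x ≤ 1 := by
  unfold rho
  split_ifs
  · rw [div_le_one (by positivity)]
    linarith [norm_nonneg x]
  · norm_num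

lemma norm_mul_rho_le_one (n : ℕ) (x : EuclideanSpace ℝ (Fin n)) : ‖x‖ * rho n x ≤ 1 := by
  unfold rho
  split_ifs
  · rw [mul_one_div, div_le_one (by positivity)]
    linarith
  · linarith

lemma potential_le (n : ℕ) {M : ℝ} (hM : 0 < M) {x y : EuclideanSpace ℝ (Fin n)}
    (hxy : ‖x - y‖ ≤ M * rho n x) :
    n + ‖x - y‖ ^ 2 / 4 + ‖x + y‖ ^ 2 / 4 ≤ (n + M ^ 2 + (2 + M) ^ 2) / rho n x ^ 2 := by
  have hpos := rho_pos n x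
  have hone := rho_le_one n x
  have hsum : ‖x + y‖ ≤ 2 * ‖x‖ + ‖x - y‖ := by
    calc ‖x + y‖ = ‖(2 : ℝ) • x - (x - y)‖ := by rw [two_smul]; congr 1; abel
      _ ≤ ‖(2 : ℝ) • x‖ + ‖x - y‖ := norm_sub_le _ _
      _ = _ := by rw [norm_smul]; norm_num
  have hsq : rho n x ^ 2 ≤ 1 := pow_le_one₀ hpos.le hone
  have hdiff : ‖x - y‖ * rho n x ≤ M := by nlinarith [norm_nonneg (x - y)]
  have hplus : ‖x + y‖ * rho n x ≤ 2 + M := by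
    nlinarith [norm_mul_rho_le_one n x, mul_le_mul_of_nonneg_right hsum hpos.le]
  have h1 : (‖x - y‖ * rho n x) ^ 2 ≤ M ^ 2 := by gcongr
  have h2 : (‖x + y‖ * rho n x) ^ 2 ≤ (2 + M) ^ 2 := by gcongr
  rw [le_div_iff₀ (by positivity)]
  nlinarith [mul_le_mul_of_nonneg_left hsq (Nat.cast_nonneg (α := ℝ) n), sq_nonneg M,
    sq_nonneg (2 + M)]

lemma mul_rpow_neg_le (n : ℕ) (hn : 1 ≤ n) {t r : ℝ} (ht : 0 < t) (hr : 0 < r) :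
    t * (t ^ 2 + r ^ 2) ^ (-((n : ℝ) / 2 + 1 / 4)) ≤ √r / r ^ n := by
  have hn' : (1 : ℝ) ≤ n := by exact_mod_cast hn
  have hsplit : (t ^ 2 + r ^ 2) ^ (-((n : ℝ) / 2 + 1 / 4)) =
      (t ^ 2 + r ^ 2) ^ (-(1 / 2) : ℝ) * (t ^ 2 + r ^ 2) ^ (-((n : ℝ) / 2 - 1 / 4)) := by
    rw [← rpow_add (by positivity)]
    congr 1
    ring
  have h1 : t * (t ^ 2 + r ^ 2) ^ (-(1 / 2) : ℝ) ≤ 1 := by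
    rw [rpow_neg (by positivity), ← sqrt_eq_rpow, ← div_eq_mul_inv, div_le_one (by positivity)]
    exact le_sqrt_of_sq_le (by nlinarith)
  have h2 : (t ^ 2 + r ^ 2) ^ (-((n : ℝ) / 2 - 1 / 4)) ≤ (r ^ 2) ^ (-((n : ℝ) / 2 - 1 / 4)) :=
    rpow_le_rpow_of_nonpos (by positivity) (by nlinarith) (by linarith)
  have h3 : (r ^ 2) ^ (-((n : ℝ) / 2 - 1 / 4)) = √r / r ^ n := by
    rw [sqrt_eq_rpow, ← rpow_natCast r n, ← rpow_sub hr, ← rpow_natCast r 2, ← rpow_mul hr.le]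
    congr 1
    push_cast
    ring
  rw [hsplit, ← mul_assoc, ← h3]
  exact (mul_le_of_le_one_left (by positivity) h1).trans h2

theorem poisson_kernel_comparison (n : ℕ) (hn : 1 ≤ n) (M : ℝ) (hM : 0 < M) :
    ∃ C > (0 : ℝ), ∀ x y : EuclideanSpace ℝ (Fin n), x ≠ y → ‖x - y‖ ≤ M * rho n x →
      ∀ t : ℝ, 0 < t →
        |P n t x y - Pclass n t (x - y)| ≤
          C * Real.sqrt (‖x - y‖ / rho n x) / ‖x - y‖ ^ n := by
  have hGamma : 0 < Real.Gamma ((n : ℝ) / 2 + 1 / 4) := Real.Gamma_pos_of_pos (by positivity)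
  refine ⟨1 / √(4 * π) * (n + M ^ 2 + (2 + M) ^ 2) ^ (1 / 4 : ℝ) * (1 / (4 * π)) ^ ((n : ℝ) / 2) *
    4 ^ ((n : ℝ) / 2 + 1 / 4) * Real.Gamma ((n : ℝ) / 2 + 1 / 4), by positivity, ?_⟩
  intro x y hne hxy t ht
  have hr : 0 < ‖x - y‖ := norm_pos_iff.2 (sub_ne_zero.2 hne)
  have hrho := rho_pos n x
  have hroot : (rho n x ^ 2) ^ (1 / 4 : ℝ) = √(rho n x) := by
    rw [sqrt_eq_rpow, ← rpow_natCast, ← rpow_mul hrho.le]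
    norm_num
  have hbound := mul_rpow_neg_le n hn ht hr
  refine (abs_P_sub_Pclass_le n hn ht x y (potential_le n hM hxy)).trans ?_
  rw [div_rpow (by positivity) (by positivity), hroot, div_rpow (x := 4) (by norm_num) (by positivity),
    sqrt_div hr.le, div_eq_mul_inv (4 ^ _), ← rpow_neg (by positivity)]
  calc _ = 1 / √(4 * π) * (n + M ^ 2 + (2 + M) ^ 2) ^ (1 / 4 : ℝ) * (1 / (4 * π)) ^ ((n : ℝ) / 2) *
        4 ^ ((n : ℝ) / 2 + 1 / 4) * Real.Gamma ((n : ℝ) / 2 + 1 / 4) / √(rho n x) *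
        (t * (t ^ 2 + ‖x - y‖ ^ 2) ^ (-((n : ℝ) / 2 + 1 / 4))) := by ring
    _ ≤ 1 / √(4 * π) * (n + M ^ 2 + (2 + M) ^ 2) ^ (1 / 4 : ℝ) * (1 / (4 * π)) ^ ((n : ℝ) / 2) *
        4 ^ ((n : ℝ) / 2 + 1 / 4) * Real.Gamma ((n : ℝ) / 2 + 1 / 4) / √(rho n x) *
        (√‖x - y‖ / ‖x - y‖ ^ n) := by gcongr
    _ = _ := by ring
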